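/- Let N ≥ 1, T > 0, let c : ℝ^N × [0,T] → ℝ be continuous satisfying (H1) and (H2), let u0 : ℝ^N → ℝ be Lipschitz continuous satisfying (H3) with constant η0 > 0 and such that {x : u0(x) ≥ 0} is compact, and let u be the continuous viscosity solution of u_t = c(x,t)|Du| with initial datum u0. Then for every t ∈ [0,T], the N-dimensional Lebesgue measure of {x ∈ ℝ^N : u(x,t) = 0} is zero, and the map t ↦ 1_{{x : u(x,t) ≥ 0}} from [0,T] into L¹(ℝ^N) is continuous. -/

import Mathlib

open Set MeasureTheory Filter Metric
open scoped Topology ENNReal NNReal RealInnerProductSpace symmDiff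

noncomputable section

/-- Euclidean space ℝ^N. -/
abbrev Euc (N : ℕ) := EuclideanSpace ℝ (Fin N)

/-- The Fréchet superdifferential D⁺v(x): the set of p with
limsup_{y→x} (v(y) − v(x) − ⟨p, y−x⟩)/|y−x| ≤ 0. -/
def SuperDiff {N : ℕ} (v : Euc N → ℝ) (x : Euc N) : Set (Euc N) :=
  {p | ∀ ε > 0, ∀ᶠ y in 𝓝[≠] x, (v y - v x - ⟪p, y - x⟫) / ‖y - x‖ ≤ ε}

/-- Semiconvexity with constant C: v(x+h) − 2v(x) + v(x−h) ≥ −C|h|². -/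
def Semiconvex {N : ℕ} (C : ℝ) (v : Euc N → ℝ) : Prop :=
  ∀ x h : Euc N, v (x + h) - 2 * v x + v (x - h) ≥ -C * ‖h‖ ^ 2

/-- Viscosity solution of u_t = c(x,t)|Du| on ℝ^N × (0,T) with initial datum u0. -/
def IsViscositySolution (N : ℕ) (T : ℝ) (c u : Euc N → ℝ → ℝ) (u0 : Euc N → ℝ) : Prop :=
  (∀ x, u x 0 = u0 x) ∧
  ∀ φ : Euc N → ℝ → ℝ,
    ContDiff ℝ 1 (fun p : Euc N × ℝ => φ p.1 p.2) →
    ∀ x0 : Euc N, ∀ t0 ∈ Set.Ioo 0 T,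
      (IsLocalMaxOn (fun p : Euc N × ℝ => u p.1 p.2 - φ p.1 p.2)
          (Set.univ ×ˢ Set.Icc 0 T) (x0, t0) →
        deriv (φ x0) t0 ≤ c x0 t0 * ‖gradient (fun x => φ x t0) x0‖) ∧
      (IsLocalMinOn (fun p : Euc N × ℝ => u p.1 p.2 - φ p.1 p.2)
          (Set.univ ×ˢ Set.Icc 0 T) (x0, t0) →
        deriv (φ x0) t0 ≥ c x0 t0 * ‖gradient (fun x => φ x t0) x0‖)

/-- `v` is a viscosity subsolution of `v_t = κ(x,t)|Dv|` on ℝ^N × (0,T). -/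
def IsViscositySubsolution {N : ℕ} (T : ℝ) (κ v : Euc N → ℝ → ℝ) : Prop :=
  ∀ φ : Euc N → ℝ → ℝ,
    ContDiff ℝ 1 (fun p : Euc N × ℝ => φ p.1 p.2) →
    ∀ x0 : Euc N, ∀ t0 ∈ Set.Ioo 0 T,
      IsLocalMaxOn (fun p : Euc N × ℝ => v p.1 p.2 - φ p.1 p.2)
          (Set.univ ×ˢ Set.Icc 0 T) (x0, t0) →
        deriv (φ x0) t0 ≤ κ x0 t0 * ‖gradient (fun x => φ x t0) x0‖

theorem IsViscositySolution.isViscositySubsolution {N : ℕ} {T : ℝ} {c u : Euc N → ℝ → ℝ}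
    {u0 : Euc N → ℝ} (h : IsViscositySolution N T c u u0) : IsViscositySubsolution T c u :=
  fun φ hφ x0 t0 ht0 hmax => (h.2 φ hφ x0 t0 ht0).1 hmax

theorem IsViscositySolution.isViscositySubsolution_neg {N : ℕ} {T : ℝ} {c u : Euc N → ℝ → ℝ}
    {u0 : Euc N → ℝ} (h : IsViscositySolution N T c u u0) :
    IsViscositySubsolution T (fun x t => -c x t) (fun x t => -u x t) := by
  intro φ hφ x0 t0 ht0 hmax
  have key := (h.2 (fun x t => -φ x t) hφ.neg x0 t0 ht0).2 (by
    have e : (fun p : Euc N × ℝ => u p.1 p.2 - -φ p.1 p.2) =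
        fun p => -(-u p.1 p.2 - φ p.1 p.2) := by
      funext p
      ring
    rw [e]
    exact hmax.neg)
  have h1 : deriv (fun t => -φ x0 t) t0 = -deriv (φ x0) t0 := deriv.fun_neg
  have h2 : gradient (fun x => -φ x t0) x0 = -gradient (fun x => φ x t0) x0 := by
    simp [gradient, fderiv_fun_neg]
  rw [h1, h2, norm_neg] at key
  linarith

theorem continuous_slice {N : ℕ} {T : ℝ} {v : Euc N → ℝ → ℝ}
    (hvc : ContinuousOn (fun p : Euc N × ℝ => v p.1 p.2)
      ((Set.univ : Set (Euc N)) ×ˢ Set.Icc (0 : ℝ) T)) {t : ℝ} (ht : t ∈ Icc 0 T) :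
    Continuous fun x => v x t := by
  rw [← continuousOn_univ]
  exact hvc.comp (f := fun x : Euc N => (x, t)) (by fun_prop) fun x _ => ⟨mem_univ _, ht⟩

theorem continuousOn_slice {N : ℕ} {T : ℝ} {v : Euc N → ℝ → ℝ}
    (hvc : ContinuousOn (fun p : Euc N × ℝ => v p.1 p.2)
      ((Set.univ : Set (Euc N)) ×ˢ Set.Icc (0 : ℝ) T)) (x : Euc N) :
    ContinuousOn (v x) (Icc 0 T) :=
  hvc.comp (f := fun t : ℝ => (x, t)) (by fun_prop) fun _ ht => ⟨mem_univ _, ht⟩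

/-- Comparison of a subsolution with a smooth supersolution on a cylinder. -/
theorem IsViscositySubsolution.le_of_barrier {N : ℕ} {T : ℝ} {κ v : Euc N → ℝ → ℝ}
    (hv : IsViscositySubsolution T κ v)
    (hvc : ContinuousOn (fun p : Euc N × ℝ => v p.1 p.2)
      ((Set.univ : Set (Euc N)) ×ˢ Set.Icc (0 : ℝ) T))
    {s τ : ℝ} (hs : 0 ≤ s) (hsτ : s < τ) (hτ : τ ≤ T) {z : Euc N} {R : ℝ}
    {ψ : Euc N → ℝ → ℝ} (hψ : ContDiff ℝ 1 (fun p : Euc N × ℝ => ψ p.1 p.2))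
    (h_init : ∀ x ∈ closedBall z R, v x s ≤ ψ x s)
    (h_lat : ∀ x ∈ sphere z R, ∀ t ∈ Icc s τ, v x t ≤ ψ x t)
    (h_int : ∀ x ∈ ball z R, ∀ t ∈ Ioo s τ,
      κ x t * ‖gradient (fun y => ψ y t) x‖ ≤ deriv (ψ x) t)
    {x : Euc N} (hx : x ∈ closedBall z R) {t : ℝ} (ht : t ∈ Icc s τ) : v x t ≤ ψ x t := by
  have hsub : Icc s τ ⊆ Icc 0 T := Icc_subset_Icc hs hτ
  have hψt : ∀ y, ContDiff ℝ 1 (ψ y) := fun y =>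
    hψ.comp (contDiff_prodMk_right y)
  suffices H : ∀ t ∈ Ioo s τ, v x t ≤ ψ x t by
    have hcl : t ∈ closure (Ioo s τ) := by rwa [closure_Ioo hsτ.ne]
    refine ContinuousWithinAt.closure_le hcl ?_ ?_ H
    · exact ((continuousOn_slice hvc x) t (hsub ht)).mono (Ioo_subset_Icc_self.trans hsub)
    · exact (hψt x).continuous.continuousWithinAt
  intro t1 ht1
  by_contra! hlt
  set ε := (v x t1 - ψ x t1) / (2 * (τ - s)) with hε
  have hτs : 0 < τ - s := sub_pos.2 hsτ
  have hεpos : 0 < ε := by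
    apply div_pos (sub_pos.2 hlt); linarith
  have hεgap : ε * (t1 - s) < v x t1 - ψ x t1 := by
    have : ε * (2 * (τ - s)) = v x t1 - ψ x t1 := by
      rw [hε]; field_simp
    nlinarith [ht1.1, ht1.2]
  set K : Set (Euc N × ℝ) := closedBall z R ×ˢ Icc s τ with hK
  have hKc : IsCompact K := (isCompact_closedBall z R).prod isCompact_Icc
  have hKsub : K ⊆ univ ×ˢ Icc 0 T := prod_mono (subset_univ _) hsub
  have hvψ : ContinuousOn (fun p : Euc N × ℝ => v p.1 p.2 - ψ p.1 p.2) K :=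
    (hvc.mono hKsub).sub hψ.continuous.continuousOn
  obtain ⟨B, hB⟩ := hKc.bddAbove_image hvψ
  have hB' : ∀ p ∈ K, v p.1 p.2 - ψ p.1 p.2 ≤ B := fun p hp => hB ⟨p, hp, rfl⟩
  have hqpos : 0 < expNegInvGlue (τ - t1) := expNegInvGlue.pos_of_pos (sub_pos.2 ht1.2)
  set M := |B| / expNegInvGlue (τ - t1) with hM
  have hM0 : 0 ≤ M := by positivity
  set χ : ℝ → ℝ := fun t => ε * (t - s) + M * expNegInvGlue (t - t1) with hχ
  have hχd : ContDiff ℝ 1 χ := by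
    have : ContDiff ℝ 1 expNegInvGlue := expNegInvGlue.contDiff (n := 1)
    fun_prop
  have hχ' : ∀ t, ε ≤ deriv χ t := by
    intro t
    have hq : DifferentiableAt ℝ expNegInvGlue (t - t1) :=
      ((expNegInvGlue.contDiff (n := 1)).differentiable (by simp)) _
    have h1 : HasDerivAt χ (ε * 1 + M * (deriv expNegInvGlue (t - t1) * 1)) t :=
      (((hasDerivAt_id t).sub_const s).const_mul ε).add
        ((HasDerivAt.comp (h₂ := expNegInvGlue) t hq.hasDerivAt
          ((hasDerivAt_id t).sub_const t1)).const_mul M)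
    rw [h1.deriv]
    have := expNegInvGlue.monotone.deriv_nonneg (x := t - t1)
    have := mul_nonneg hM0 this
    linarith
  have hφ : ContDiff ℝ 1 (fun p : Euc N × ℝ => ψ p.1 p.2 + χ p.2) := by fun_prop
  obtain ⟨⟨x2, t2⟩, hp2, hmax⟩ := hKc.exists_isMaxOn ⟨(x, t1), hx, Ioo_subset_Icc_self ht1⟩
    (f := fun p : Euc N × ℝ => v p.1 p.2 - (ψ p.1 p.2 + χ p.2))
    ((hvc.mono hKsub).sub hφ.continuous.continuousOn)
  have hpos : 0 < v x2 t2 - (ψ x2 t2 + χ t2) := by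
    have := hmax (a := (x, t1)) ⟨hx, Ioo_subset_Icc_self ht1⟩
    simp only [hχ, mem_ofPred_eq, sub_self, expNegInvGlue.zero, mul_zero, add_zero] at this
    linarith
  have hχ0 : 0 ≤ χ t2 := add_nonneg (mul_nonneg hεpos.le (sub_nonneg.2 hp2.2.1))
    (mul_nonneg hM0 (expNegInvGlue.nonneg _))
  have hx2 : x2 ∈ ball z R := by
    rcases (mem_closedBall.1 hp2.1).lt_or_eq with h | h
    · exact h
    · have := h_lat x2 h t2 hp2.2
      linarith
  have hst2 : s < t2 := by
    rcases hp2.2.1.lt_or_eq with h | h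
    · exact h
    · have := h_init x2 hp2.1
      simp only at h
      rw [h] at this
      linarith
  have htτ2 : t2 < τ := by
    rcases hp2.2.2.lt_or_eq with h | h
    · exact h
    · exfalso
      have h1 := hB' _ hp2
      simp only at h h1
      have h2 : |B| ≤ χ t2 := by
        have : M * expNegInvGlue (t2 - t1) = |B| := by
          rw [h, hM]; field_simp
        simp only [hχ, this]
        have := mul_nonneg hεpos.le (sub_nonneg.2 hst2.le)
        linarith
      linarith [le_abs_self B]
  have hnhds : K ∈ 𝓝 (x2, t2) :=
    prod_mem_nhds (closedBall_mem_nhds_of_mem hx2) (Icc_mem_nhds hst2 htτ2)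
  have hvis := hv (fun y t => ψ y t + χ t) hφ x2 t2
    ⟨hs.trans_lt hst2, htτ2.trans_le hτ⟩ ((hmax.isLocalMax hnhds).on _)
  have hg : gradient (fun y => ψ y t2 + χ t2) x2 = gradient (fun y => ψ y t2) x2 := by
    simp [gradient, fderiv_add_const]
  have hd : deriv (fun t => ψ x2 t + χ t) t2 = deriv (ψ x2) t2 + deriv χ t2 :=
    deriv_fun_add ((hψt x2).differentiable (by simp) _) (hχd.differentiable (by simp) _)
  rw [hg, hd] at hvis
  linarith [h_int x2 hx2 t2 ⟨hst2, htτ2⟩, hχ' t2]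

theorem exists_closedBall_add_forall_lt {N : ℕ} {f : Euc N → ℝ} (hf : Continuous f) {z : Euc N}
    {r m : ℝ} (hr : 0 ≤ r) (h : ∀ x ∈ closedBall z r, f x < m) :
    ∃ δ > 0, ∀ x ∈ closedBall z (r + δ), f x < m := by
  obtain ⟨δ, hδ, hsub⟩ := (isCompact_closedBall z r).exists_cthickening_subset_open
    (isOpen_lt hf (continuous_const (y := m))) h
  refine ⟨δ, hδ, fun x hx => hsub ?_⟩
  rw [cthickening_closedBall hδ.le hr]
  rwa [add_comm] at hx

/-- Finite speed of propagation for subsolutions, up to an error. -/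
theorem IsViscositySubsolution.le_of_forall_le {N : ℕ} {T : ℝ} {κ v : Euc N → ℝ → ℝ}
    (hv : IsViscositySubsolution T κ v)
    (hvc : ContinuousOn (fun p : Euc N × ℝ => v p.1 p.2)
      ((Set.univ : Set (Euc N)) ×ˢ Set.Icc (0 : ℝ) T))
    {s τ : ℝ} (hs : 0 ≤ s) (hsτ : s < τ) (hτ : τ ≤ T) {z : Euc N} {C δ m : ℝ}
    (hC : 0 ≤ C) (hδ : 0 < δ)
    (hκ : ∀ x ∈ closedBall z (C * (τ - s) + δ), ∀ t ∈ Icc s τ, κ x t ≤ C)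
    (h_init : ∀ x ∈ closedBall z (C * (τ - s) + δ), v x s ≤ m) : v z τ ≤ m := by
  have hsub : Icc s τ ⊆ Icc 0 T := Icc_subset_Icc hs hτ
  have hτs : 0 < τ - s := sub_pos.2 hsτ
  set R := C * (τ - s) + δ with hR
  have hR0 : 0 ≤ R := by positivity
  obtain ⟨B, hB⟩ := ((isCompact_closedBall z R).prod
    (isCompact_Icc (a := s) (b := τ))).bddAbove_image (hvc.mono (prod_mono (subset_univ _) hsub))
  have hB' : ∀ x ∈ closedBall z R, ∀ t ∈ Icc s τ, v x t ≤ B :=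
    fun x hx t ht => hB ⟨(x, t), ⟨hx, ht⟩, rfl⟩
  have hqpos : 0 < expNegInvGlue (δ / 2) := expNegInvGlue.pos_of_pos (by positivity)
  set M := (|B| + |m|) / expNegInvGlue (δ / 2) with hM
  have hM0 : 0 ≤ M := by positivity
  have hMq : M * expNegInvGlue (δ / 2) = |B| + |m| := by
    rw [hM]; field_simp
  have hqd : ContDiff ℝ 1 expNegInvGlue := expNegInvGlue.contDiff (n := 1)
  have hrad : ∀ y : Euc N, 0 < (δ / 4) ^ 2 + ‖y‖ ^ 2 := fun y => by positivity
  set ρ : Euc N → ℝ := fun x => √((δ / 4) ^ 2 + ‖x - z‖ ^ 2) with hρ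
  have hρd : ContDiff ℝ 1 ρ := by
    refine ContDiff.sqrt ?_ fun x => (hrad _).ne'
    exact contDiff_const.add ((contDiff_id.sub contDiff_const).norm_sq ℝ)
  set g : Euc N → ℝ → ℝ := fun x t => ρ x + C * (t - s) - (C * (τ - s) + δ / 2) with hg
  set ψ : Euc N → ℝ → ℝ := fun x t => m + M * expNegInvGlue (g x t) with hψ
  have hψd : ContDiff ℝ 1 (fun p : Euc N × ℝ => ψ p.1 p.2) := by
    simp only [hψ, hg]
    fun_prop
  have hle := hv.le_of_barrier hvc hs hsτ hτ hψd (z := z) (R := R) ?_ ?_ ?_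
    (mem_closedBall_self hR0) (right_mem_Icc.2 hsτ.le)
  · have : g z τ ≤ 0 := by
      simp only [hg, hρ, sub_self, norm_zero]
      rw [zero_pow two_ne_zero, add_zero, Real.sqrt_sq (by positivity)]
      linarith
    simpa [hψ, expNegInvGlue.zero_of_nonpos this] using hle
  · intro x hx
    have := mul_nonneg hM0 (expNegInvGlue.nonneg (g x s))
    linarith [h_init x hx]
  · intro x hx t ht
    have h1 : R ≤ ρ x := by
      apply Real.le_sqrt_of_sq_le
      rw [← mem_sphere_iff_norm.1 hx]
      nlinarith
    have h2 : δ / 2 ≤ g x t := by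
      have := mul_nonneg hC (sub_nonneg.2 ht.1)
      simp only [hg]
      linarith
    have h3 : |B| + |m| ≤ M * expNegInvGlue (g x t) := by
      rw [← hMq]
      exact mul_le_mul_of_nonneg_left (expNegInvGlue.monotone h2) hM0
    have h4 := hB' x (sphere_subset_closedBall hx) t ht
    simp only [hψ]
    linarith [le_abs_self B, neg_abs_le m]
  · intro x hx t ht
    set q' := deriv expNegInvGlue (g x t) with hq'
    have hq'0 : 0 ≤ q' := expNegInvGlue.monotone.deriv_nonneg
    have hqt : HasDerivAt expNegInvGlue q' (g x t) :=
      (hqd.differentiable (by simp) _).hasDerivAt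
    have hdt : HasDerivAt (ψ x) (M * (q' * C)) t := by
      have h1 : HasDerivAt (g x) C t := by
        exact (((((hasDerivAt_id t).sub_const s).const_mul C).const_add (ρ x)).sub_const
          (C * (τ - s) + δ / 2)).congr_deriv (mul_one C)
      exact ((hqt.comp t h1).const_mul M).const_add m
    have hρx : 0 < ρ x := Real.sqrt_pos.2 (hrad _)
    have hdx : HasGradientAt (fun y => ψ y t) ((M * q' / ρ x) • (x - z)) x := by
      rw [hasGradientAt_iff_hasFDerivAt]
      have h0 : HasFDerivAt (fun y : Euc N => (δ / 4) ^ 2 + ‖y - z‖ ^ 2)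
          (2 • (innerSL ℝ (x - z)) ∘SL ContinuousLinearMap.id ℝ (Euc N)) x :=
        (((hasFDerivAt_id x).sub_const z).norm_sq).const_add _
      have h1 := h0.sqrt (hrad _).ne'
      have h2 := ((h1.add_const (C * (t - s))).sub_const (C * (τ - s) + δ / 2))
      have h3 := ((hqt.comp_hasFDerivAt x h2).const_mul M).const_add m
      refine h3.congr_fderiv ?_
      ext y
      simp [hρ]
      field_simp
    rw [hdt.deriv, hdx.gradient, norm_smul, Real.norm_of_nonneg (by positivity)]
    have h1 : ‖x - z‖ ≤ ρ x := Real.le_sqrt_of_sq_le (by nlinarith)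
    have h2 : M * q' / ρ x * ‖x - z‖ ≤ M * q' := by
      rw [div_mul_eq_mul_div, div_le_iff₀ hρx]
      exact mul_le_mul_of_nonneg_left h1 (by positivity)
    have h3 := hκ x (ball_subset_closedBall hx) t (Ioo_subset_Icc_self ht)
    calc κ x t * (M * q' / ρ x * ‖x - z‖) ≤ C * (M * q' / ρ x * ‖x - z‖) := by gcongr
      _ ≤ C * (M * q') := by gcongr
      _ = M * (q' * C) := by ring

/-- Finite speed of propagation for subsolutions. -/
theorem IsViscositySubsolution.exists_le {N : ℕ} {T : ℝ} {κ v : Euc N → ℝ → ℝ}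
    (hv : IsViscositySubsolution T κ v)
    (hvc : ContinuousOn (fun p : Euc N × ℝ => v p.1 p.2)
      ((Set.univ : Set (Euc N)) ×ˢ Set.Icc (0 : ℝ) T))
    {s τ : ℝ} (hs : 0 ≤ s) (hsτ : s < τ) (hτ : τ ≤ T) {z : Euc N} {C δ : ℝ}
    (hC : 0 ≤ C) (hδ : 0 < δ)
    (hκ : ∀ x ∈ closedBall z (C * (τ - s) + δ), ∀ t ∈ Icc s τ, κ x t ≤ C) :
    ∃ x ∈ closedBall z (C * (τ - s)), v z τ ≤ v x s := by
  have hτs : 0 < τ - s := sub_pos.2 hsτ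
  have hcont := continuous_slice hvc (t := s) ⟨hs, hsτ.le.trans hτ⟩
  obtain ⟨x, hx, hmax⟩ := (isCompact_closedBall z (C * (τ - s))).exists_isMaxOn
    ⟨z, mem_closedBall_self (by positivity)⟩ hcont.continuousOn
  refine ⟨x, hx, le_of_forall_pos_le_add fun ε hε => ?_⟩
  obtain ⟨δ', hδ', h⟩ := exists_closedBall_add_forall_lt hcont (z := z) (m := v x s + ε)
    (r := C * (τ - s)) (by positivity) fun y hy => (hmax hy).trans_lt (lt_add_of_pos_right _ hε)
  have hsub : ∀ d, min δ δ' ≤ d →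
      closedBall z (C * (τ - s) + min δ δ') ⊆ closedBall z (C * (τ - s) + d) := fun d hd =>
    closedBall_subset_closedBall (by linarith)
  exact hv.le_of_forall_le hvc hs hsτ hτ hC (lt_min hδ hδ')
    (fun y hy => hκ y (hsub δ (min_le_left _ _) hy))
    (fun y hy => (h y (hsub δ' (min_le_right _ _) hy)).le)

/-- A subsolution of `v_t = -c|Dv|` does not increase along segments of speed at most `c`. -/
theorem IsViscositySubsolution.le_of_norm_le {N : ℕ} {T : ℝ} {c v : Euc N → ℝ → ℝ}
    (hv : IsViscositySubsolution T (fun x t => -c x t) v)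
    (hvc : ContinuousOn (fun p : Euc N × ℝ => v p.1 p.2)
      ((Set.univ : Set (Euc N)) ×ˢ Set.Icc (0 : ℝ) T))
    {s τ : ℝ} (hs : 0 ≤ s) (hsτ : s < τ) (hτ : τ ≤ T) {z w : Euc N} {δ : ℝ} (hδ : 0 < δ)
    (hc : ∀ x ∈ closedBall z (‖w‖ * (τ - s) + δ), ∀ t ∈ Icc s τ, ‖w‖ ≤ c x t) :
    v (z + (τ - s) • w) τ ≤ v z s := by
  have hsub : Icc s τ ⊆ Icc 0 T := Icc_subset_Icc hs hτ
  have hτs : 0 < τ - s := sub_pos.2 hsτ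
  refine le_of_forall_pos_le_add fun ε hε => ?_
  have hcont := continuous_slice hvc (t := s) ⟨hs, hsτ.le.trans hτ⟩
  obtain ⟨δ', hδ', hinit⟩ := exists_closedBall_add_forall_lt hcont (z := z) (m := v z s + ε)
    le_rfl fun y hy => by
      rw [closedBall_zero, mem_singleton_iff] at hy
      rw [hy]
      linarith
  rw [zero_add] at hinit
  set m := v z s + ε
  set d := min δ δ' with hd
  have hd0 : 0 < d := lt_min hδ hδ'
  set R := ‖w‖ * (τ - s) + δ with hR
  have hR0 : 0 ≤ R := by positivity
  obtain ⟨B, hB⟩ := ((isCompact_closedBall z R).prod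
    (isCompact_Icc (a := s) (b := τ))).bddAbove_image (hvc.mono (prod_mono (subset_univ _) hsub))
  have hB' : ∀ x ∈ closedBall z R, ∀ t ∈ Icc s τ, v x t ≤ B :=
    fun x hx t ht => hB ⟨(x, t), ⟨hx, ht⟩, rfl⟩
  set M := (|B| + |m|) / d ^ 2 with hM
  have hM0 : 0 ≤ M := by positivity
  have hMd : ∀ y : Euc N, d ≤ ‖y‖ → B ≤ m + M * ‖y‖ ^ 2 := by
    intro y hy
    have h1 : M * d ^ 2 = |B| + |m| := by
      rw [hM]; field_simp
    have h2 : M * d ^ 2 ≤ M * ‖y‖ ^ 2 := by gcongr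
    linarith [le_abs_self B, neg_abs_le m]
  set ψ : Euc N → ℝ → ℝ := fun x t => m + M * ‖x - z - (t - s) • w‖ ^ 2 with hψ
  have hψd : ContDiff ℝ 1 (fun p : Euc N × ℝ => ψ p.1 p.2) := by
    simp only [hψ]
    refine contDiff_const.add (contDiff_const.mul (ContDiff.norm_sq ℝ ?_))
    fun_prop
  have hle := hv.le_of_barrier hvc hs hsτ hτ hψd (z := z) (R := R) ?_ ?_ ?_
    (x := z + (τ - s) • w) ?_ (right_mem_Icc.2 hsτ.le)
  · simpa [hψ] using hle
  · intro x hx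
    by_cases hxd : ‖x - z‖ ≤ δ'
    · have h1 := hinit x (mem_closedBall_iff_norm.2 hxd)
      have h2 : 0 ≤ M * ‖x - z - (s - s) • w‖ ^ 2 := by positivity
      simp only [hψ]
      linarith
    · have h1 := hMd (x - z - (s - s) • w) (by
        simp only [sub_self, zero_smul, sub_zero]
        exact (min_le_right _ _).trans (not_le.1 hxd).le)
      exact (hB' x hx s (left_mem_Icc.2 hsτ.le)).trans h1
  · intro x hx t ht
    refine (hB' x (sphere_subset_closedBall hx) t ht).trans (hMd _ ?_)
    have h1 : ‖x - z‖ = R := mem_sphere_iff_norm.1 hx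
    have h2 : ‖(t - s) • w‖ ≤ (τ - s) * ‖w‖ := by
      rw [norm_smul, Real.norm_of_nonneg (sub_nonneg.2 ht.1)]
      gcongr
      exact ht.2
    have h3 := norm_sub_norm_le (x - z) ((t - s) • w)
    have : d ≤ δ := min_le_left _ _
    linarith
  · intro x hx t ht
    set y := x - z - (t - s) • w with hy
    have hdt : HasDerivAt (ψ x) (M * (2 * ⟪y, -w⟫)) t := by
      have h1 : HasDerivAt (fun t : ℝ => x - z - (t - s) • w) (-w) t := by
        simpa using (((hasDerivAt_id t).sub_const s).smul_const w).const_sub (x - z)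
      exact (h1.norm_sq.const_mul M).const_add m
    have hdx : HasGradientAt (fun y => ψ y t) ((2 * M) • y) x := by
      rw [hasGradientAt_iff_hasFDerivAt]
      have h0 : HasFDerivAt (fun x : Euc N => ‖x - z - (t - s) • w‖ ^ 2)
          (2 • (innerSL ℝ y) ∘SL ContinuousLinearMap.id ℝ (Euc N)) x :=
        (((hasFDerivAt_id x).sub_const z).sub_const _).norm_sq
      refine ((h0.const_mul M).const_add m).congr_fderiv ?_
      ext y'
      simp
      ring
    rw [hdt.deriv, hdx.gradient, norm_smul, Real.norm_of_nonneg (by positivity), inner_neg_right]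
    have h1 := hc x (ball_subset_closedBall hx) t (Ioo_subset_Icc_self ht)
    have h2 : ⟪y, w⟫ ≤ c x t * ‖y‖ := (real_inner_le_norm y w).trans (by
      rw [mul_comm]; gcongr)
    nlinarith [mul_le_mul_of_nonneg_left h2 hM0]
  · simp only [mem_closedBall_iff_norm, add_sub_cancel_left, norm_smul,
      Real.norm_of_nonneg hτs.le, hR]
    linarith

/-- A lower bound on superdifferentials near the zero level forces uniform growth. -/
theorem exists_mul_le_of_superDiff {N : ℕ} {u0 : Euc N → ℝ} (hcont : Continuous u0) {η0 : ℝ}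
    (hη0 : 0 < η0) (hH3 : ∀ x : Euc N, ∀ p ∈ SuperDiff u0 x, η0 ≤ |u0 x| + ‖p‖)
    {x : Euc N} (hx : 0 ≤ u0 x) {r : ℝ} (hr : 0 < r) (hr1 : r ≤ 1) :
    ∃ y ∈ closedBall x r, η0 / 4 * r ≤ u0 y := by
  by_contra! hlt
  set b := η0 / 4 / r with hb
  have hb0 : 0 < b := by positivity
  have hbr : b * r = η0 / 4 := by rw [hb]; field_simp
  obtain ⟨z, hz, hmax⟩ := (isCompact_closedBall x r).exists_isMaxOn
    ⟨x, mem_closedBall_self hr.le⟩ (f := fun y => u0 y - b * ‖y - x‖ ^ 2)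
    (by fun_prop)
  have hzx : u0 x ≤ u0 z - b * ‖z - x‖ ^ 2 := by
    simpa using hmax (mem_closedBall_self hr.le)
  have hzu := hlt z hz
  have hz0 : 0 ≤ u0 z := by
    have : 0 ≤ b * ‖z - x‖ ^ 2 := by positivity
    linarith
  have hzr : ‖z - x‖ ≤ r := mem_closedBall_iff_norm.1 hz
  have hzlt : ‖z - x‖ < r := by
    refine lt_of_le_of_ne hzr fun h => ?_
    rw [h] at hzx
    nlinarith
  have hball : ball x r ∈ 𝓝 z := isOpen_ball.mem_nhds (mem_ball_iff_norm.2 hzlt)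
  have hp : (2 * b) • (z - x) ∈ SuperDiff u0 z := by
    intro ε hε
    have hnear : ball z (ε / b) ∈ 𝓝 z := ball_mem_nhds z (by positivity)
    filter_upwards [mem_nhdsWithin_of_mem_nhds hball, mem_nhdsWithin_of_mem_nhds hnear,
      self_mem_nhdsWithin] with y hy hyε hne
    have hpos : 0 < ‖y - z‖ := norm_pos_iff.2 (sub_ne_zero.2 hne)
    rw [div_le_iff₀ hpos, real_inner_smul_left]
    have h1 := hmax (ball_subset_closedBall hy)
    simp only [mem_ofPred_eq] at h1
    have h2 : ‖y - x‖ ^ 2 = ‖z - x‖ ^ 2 + 2 * ⟪z - x, y - z⟫ + ‖y - z‖ ^ 2 := by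
      rw [← norm_add_sq_real]
      congr 2
      abel
    have h3 : b * ‖y - z‖ ≤ ε := by
      have := mem_ball_iff_norm.1 hyε
      rw [lt_div_iff₀ hb0] at this
      linarith
    rw [h2] at h1
    nlinarith
  have h := hH3 z _ hp
  rw [norm_smul, Real.norm_of_nonneg (by positivity), abs_of_nonneg hz0] at h
  have h1 : 2 * b * ‖z - x‖ ≤ 2 * (η0 / 4) := by
    rw [← hbr, ← mul_assoc]
    gcongr
  nlinarith

/-- Every point where `f ≥ 0` is within `d` of the centre of a ball of radius `ρ` where `f ≥ m`. -/
def NonnegNearBall {N : ℕ} (f : Euc N → ℝ) (m ρ d : ℝ) : Prop :=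
  ∀ x, 0 ≤ f x → ∃ y ∈ closedBall x d, ∀ w ∈ closedBall y ρ, m ≤ f w

theorem NonnegNearBall.mono {N : ℕ} {f : Euc N → ℝ} {m ρ d d' : ℝ}
    (h : NonnegNearBall f m ρ d) (hd : d ≤ d') : NonnegNearBall f m ρ d' := fun x hx =>
  let ⟨y, hy, hyw⟩ := h x hx
  ⟨y, closedBall_subset_closedBall hd hy, hyw⟩

theorem LipschitzWith.nonnegNearBall {N : ℕ} {u0 : Euc N → ℝ} {K : ℝ≥0}
    (hu0 : LipschitzWith K u0) {η0 : ℝ}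
    (hη0 : 0 < η0) (hH3 : ∀ x : Euc N, ∀ p ∈ SuperDiff u0 x, η0 ≤ |u0 x| + ‖p‖)
    {r : ℝ} (hr : 0 < r) (hr1 : r ≤ 1) :
    NonnegNearBall u0 (η0 / 8 * r) (η0 / (8 * (K + 1)) * r) r := by
  intro x hx
  obtain ⟨y, hy, hyu⟩ := exists_mul_le_of_superDiff hu0.continuous hη0 hH3 hx hr hr1
  refine ⟨y, hy, fun w hw => ?_⟩
  have h1 := hu0.dist_le_mul y w
  rw [Real.dist_eq, dist_comm] at h1
  have hK : (0 : ℝ) ≤ K := K.2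
  have h2 : (K : ℝ) * dist w y ≤ (K + 1) * (η0 / (8 * (K + 1)) * r) := by
    have := mem_closedBall.1 hw
    gcongr
    linarith
  have h3 : ((K : ℝ) + 1) * (η0 / (8 * (K + 1)) * r) = η0 / 8 * r := by
    field_simp
  linarith [le_abs_self (u0 y - u0 w)]

/-- One time step in the propagation of `NonnegNearBall`. -/
theorem IsViscositySolution.nonnegNearBall_add {N : ℕ} {T : ℝ} {c u : Euc N → ℝ → ℝ}
    {u0 : Euc N → ℝ} (husol : IsViscositySolution N T c u u0)
    (huc : ContinuousOn (fun p : Euc N × ℝ => u p.1 p.2)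
      ((Set.univ : Set (Euc N)) ×ˢ Set.Icc (0 : ℝ) T))
    {L1 L1' : ℝ} (hL1 : 0 < L1)
    (hH1 : ∀ x y : Euc N, ∀ t ∈ Set.Icc (0 : ℝ) T,
      |c x t - c y t| ≤ L1 * ‖x - y‖ ∧ |c x t| ≤ L1')
    (hH2 : ∀ x : Euc N, ∀ t ∈ Set.Icc (0 : ℝ) T, 0 ≤ c x t)
    {s h m ρ d r : ℝ} (hs : 0 ≤ s) (hh : 0 < h) (hsT : s + h ≤ T) (hρ : 0 ≤ ρ) (hd : 0 ≤ d)
    (hr : 0 < r)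
    (htime : ∀ x, 0 ≤ u x (s + h) → ∀ t ∈ Icc s (s + h), |c x t - c x s| ≤ r)
    (hsmall : L1 * (2 * (L1' + 2 * r) + 1) * h ≤ r)
    (hP : NonnegNearBall (fun x => u x s) m ρ d) :
    NonnegNearBall (fun x => u x (s + h)) m ρ (d + h * (4 * r + L1 * (ρ + d))) := by
  intro x hx
  have hsub : Icc s (s + h) ⊆ Icc 0 T := Icc_subset_Icc hs hsT
  have hs0 : s ∈ Icc 0 T := hsub (left_mem_Icc.2 (by linarith))
  have hcx0 := hH2 x s hs0
  have hcxL := (le_abs_self _).trans (hH1 x x s hs0).2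
  set C := c x s + 2 * r with hC
  have hCpos : 0 < C := by positivity
  have hsmall' : L1 * (2 * (C * h) + h) ≤ r := by
    refine le_trans ?_ hsmall
    have : C ≤ L1' + 2 * r := by linarith
    calc L1 * (2 * (C * h) + h) = L1 * (2 * C + 1) * h := by ring
      _ ≤ _ := by gcongr
  have hosc : ∀ q, ∀ t ∈ Icc s (s + h), |c q t - c x s| ≤ r + L1 * ‖q - x‖ := fun q t ht => by
    have h1 := (hH1 q x t (hsub ht)).1
    have h2 := htime x hx t ht
    have h3 := abs_sub_le (c q t) (c x t) (c x s)
    linarith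
  obtain ⟨z, hz, hzu⟩ := husol.isViscositySubsolution.exists_le huc hs (lt_add_of_pos_right s hh)
    hsT (z := x) hCpos.le hh fun q hq t ht => by
      rw [add_sub_cancel_left, mem_closedBall_iff_norm] at hq
      have h1 := (le_abs_self _).trans (hosc q t ht)
      have h2 : L1 * ‖q - x‖ ≤ L1 * (2 * (C * h) + h) := by
        gcongr
        nlinarith
      linarith
  rw [add_sub_cancel_left, mem_closedBall_iff_norm'] at hz
  obtain ⟨y, hy, hyw⟩ := hP z (hx.trans hzu)
  rw [mem_closedBall_iff_norm] at hy
  set σ := max 0 (C - 4 * r - L1 * (ρ + d)) with hσ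
  have hσ0 : 0 ≤ σ := le_max_left _ _
  have hσC : σ ≤ C := max_le hCpos.le (by
    have : 0 ≤ L1 * (ρ + d) := by positivity
    linarith)
  set θ := σ / C with hθ
  have hθ0 : 0 ≤ θ := by positivity
  have hθ1 : θ ≤ 1 := div_le_one_of_le₀ hσC hCpos.le
  have hθC : θ * C = σ := by rw [hθ]; field_simp
  set w := (θ / h) • (x - z) with hw
  have hhw : h • w = θ • (x - z) := by
    rw [hw, smul_smul]
    congr 1
    field_simp
  have hwσ : ‖w‖ ≤ σ := by
    rw [hw, norm_smul, Real.norm_of_nonneg (by positivity), div_mul_eq_mul_div, div_le_iff₀ hh,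
      ← hθC, mul_assoc]
    gcongr
  refine ⟨y + h • w, ?_, fun q hq => ?_⟩
  · have e : y + h • w - x = (y - z) - (1 - θ) • (x - z) := by
      rw [hhw, sub_smul, one_smul]
      abel
    rw [mem_closedBall_iff_norm, e]
    refine (norm_sub_le _ _).trans ?_
    rw [norm_smul, Real.norm_of_nonneg (sub_nonneg.2 hθ1)]
    have h1 : (1 - θ) * ‖x - z‖ ≤ (1 - θ) * (C * h) :=
      mul_le_mul_of_nonneg_left hz (sub_nonneg.2 hθ1)
    have h2 : (1 - θ) * (C * h) = h * (C - σ) := by rw [← hθC]; ring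
    have h3 : h * (C - σ) ≤ h * (4 * r + L1 * (ρ + d)) := by
      gcongr
      have := le_max_right 0 (C - 4 * r - L1 * (ρ + d))
      linarith
    linarith
  · set p := q - h • w with hp
    have hpy : ‖p - y‖ ≤ ρ := by
      have e : p - y = q - (y + h • w) := by
        rw [hp]
        abel
      rw [e]
      exact mem_closedBall_iff_norm.1 hq
    have hstep := husol.isViscositySubsolution_neg.le_of_norm_le huc.neg hs
      (lt_add_of_pos_right s hh) hsT (z := p) (w := w) hh fun x' hx' t ht => by
        refine hwσ.trans (max_le (hH2 x' t (hsub ht)) ?_)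
        rw [add_sub_cancel_left, mem_closedBall_iff_norm] at hx'
        have h1 := neg_le_of_abs_le (hosc x' t ht)
        have h2 : ‖x' - x‖ ≤ (‖x' - p‖ + ‖p - y‖) + (‖y - z‖ + ‖x - z‖) := by
          have e : x' - x = ((x' - p) + (p - y)) + ((y - z) - (x - z)) := by abel
          rw [e]
          exact (norm_add_le _ _).trans <| add_le_add (norm_add_le _ _) (norm_sub_le _ _)
        have h3 : ‖w‖ * h ≤ C * h := by
          gcongr
          exact hwσ.trans hσC
        have h4 : L1 * ‖x' - x‖ ≤ L1 * ((2 * (C * h) + h) + (ρ + d)) := by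
          gcongr
          linarith
        rw [mul_add] at h4
        linarith
    rw [add_sub_cancel_left, hp, sub_add_cancel] at hstep
    have := hyw p (mem_closedBall_iff_norm.2 hpy)
    simp only at this ⊢
    linarith

/-- The nonnegativity sets of a solution remain bounded. -/
theorem IsViscositySolution.exists_nonneg_subset_closedBall {N : ℕ} {T : ℝ}
    {c u : Euc N → ℝ → ℝ} {u0 : Euc N → ℝ} (husol : IsViscositySolution N T c u u0)
    (huc : ContinuousOn (fun p : Euc N × ℝ => u p.1 p.2)
      ((Set.univ : Set (Euc N)) ×ˢ Set.Icc (0 : ℝ) T))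
    {C : ℝ} (hC : 0 ≤ C) (hcC : ∀ x, ∀ t ∈ Icc 0 T, c x t ≤ C)
    (hbdd : Bornology.IsBounded {x : Euc N | 0 ≤ u0 x}) :
    ∃ R, ∀ t ∈ Icc 0 T, {x | 0 ≤ u x t} ⊆ closedBall 0 R := by
  obtain ⟨R, hR⟩ := hbdd.subset_closedBall 0
  refine ⟨R + C * T, fun t ht x hx => ?_⟩
  have hx : 0 ≤ u x t := hx
  have hCT : C * t ≤ C * T := by
    gcongr
    exact ht.2
  rcases ht.1.eq_or_lt with rfl | htpos
  · rw [husol.1] at hx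
    exact closedBall_subset_closedBall (by linarith) (hR hx)
  · obtain ⟨z, hz, hzu⟩ := husol.isViscositySubsolution.exists_le huc le_rfl htpos ht.2
      (z := x) hC one_pos fun q _ t' ht' => hcC q t' ⟨ht'.1, ht'.2.trans ht.2⟩
    have h1 : 0 ≤ u0 z := by
      rw [← husol.1]
      exact hx.trans hzu
    have h2 := mem_closedBall_zero_iff.1 (hR h1)
    rw [sub_zero, mem_closedBall_iff_norm'] at hz
    rw [mem_closedBall_zero_iff]
    have h3 := norm_add_le (x - z) z
    rw [sub_add_cancel] at h3
    linarith

/-- Propagation in time of `NonnegNearBall`. -/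
theorem IsViscositySolution.nonnegNearBall {N : ℕ} {T : ℝ} {c u : Euc N → ℝ → ℝ}
    {u0 : Euc N → ℝ} (husol : IsViscositySolution N T c u u0)
    (hc : ContinuousOn (fun p : Euc N × ℝ => c p.1 p.2)
      ((Set.univ : Set (Euc N)) ×ˢ Set.Icc (0 : ℝ) T))
    (huc : ContinuousOn (fun p : Euc N × ℝ => u p.1 p.2)
      ((Set.univ : Set (Euc N)) ×ˢ Set.Icc (0 : ℝ) T))
    {L1 L1' : ℝ} (hL1 : 0 < L1) (hL1' : 0 < L1')
    (hH1 : ∀ x y : Euc N, ∀ t ∈ Set.Icc (0 : ℝ) T,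
      |c x t - c y t| ≤ L1 * ‖x - y‖ ∧ |c x t| ≤ L1')
    (hH2 : ∀ x : Euc N, ∀ t ∈ Set.Icc (0 : ℝ) T, 0 ≤ c x t)
    {R : ℝ} (hR : ∀ t ∈ Icc 0 T, {x | 0 ≤ u x t} ⊆ closedBall 0 R)
    {m ρ d r : ℝ} (hρ : 0 ≤ ρ) (hd : 0 ≤ d) (hr : 0 < r) (hP : NonnegNearBall u0 m ρ d)
    {t : ℝ} (ht : t ∈ Icc 0 T) :
    NonnegNearBall (fun x => u x t) m ρ ((d + ρ + 4 * r / L1) * Real.exp (L1 * t)) := by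
  have hP0 : NonnegNearBall (fun x => u x 0) m ρ d := by simpa only [husol.1] using hP
  set b := ρ + 4 * r / L1 with hb
  have hb0 : 0 ≤ b := by positivity
  have hLb : L1 * b = L1 * ρ + 4 * r := by rw [hb]; field_simp
  have hdb : d + ρ + 4 * r / L1 = d + b := by rw [hb]; ring
  rw [hdb]
  rcases ht.1.eq_or_lt with rfl | htpos
  · exact hP0.mono (by simpa using hb0)
  have huni := ((isCompact_closedBall (0 : Euc N) R).prod
    (isCompact_Icc (a := 0) (b := T))).uniformContinuousOn_of_continuous
    (hc.mono (prod_mono (subset_univ _) subset_rfl))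
  obtain ⟨δ, hδ, hcδ⟩ := Metric.uniformContinuousOn_iff.1 huni r hr
  set A := L1 * (2 * (L1' + 2 * r) + 1) with hA
  have hA0 : 0 < A := by positivity
  obtain ⟨n, hn⟩ := exists_nat_gt (t / min (δ / 2) (r / A))
  have hmin : 0 < min (δ / 2) (r / A) := lt_min (by positivity) (by positivity)
  have hn0 : 0 < (n : ℝ) := (by positivity : 0 ≤ t / min (δ / 2) (r / A)).trans_lt hn
  set h := t / n with hh
  have hhpos : 0 < h := by positivity
  have hhmin : h < min (δ / 2) (r / A) := by
    rw [div_lt_iff₀ hmin] at hn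
    rw [hh, div_lt_iff₀ hn0]
    linarith
  have hhδ : h < δ := by linarith [hhmin.trans_le (min_le_left _ _)]
  have hhr : A * h ≤ r := by
    have := (hhmin.trans_le (min_le_right _ _)).le
    rw [le_div_iff₀ hA0] at this
    linarith
  have hnh : (n : ℝ) * h = t := by rw [hh]; field_simp
  suffices H : ∀ k : ℕ, k ≤ n → NonnegNearBall (fun x => u x (k * h)) m ρ
      ((d + b) * Real.exp (L1 * (k * h)) - b) by
    have := H n le_rfl
    rw [hnh] at this
    exact this.mono (by linarith)
  intro k
  induction k with
  | zero =>
    intro _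
    simpa using hP0
  | succ k ih =>
    intro hk
    have hkh : (0 : ℝ) ≤ k * h := by positivity
    have e : ((k + 1 : ℕ) : ℝ) * h = k * h + h := by push_cast; ring
    have hkT : k * h + h ≤ T := by
      rw [← e]
      refine le_trans ?_ ht.2
      rw [← hnh]
      gcongr
    have hkT' : k * h + h ∈ Icc 0 T := ⟨by linarith, hkT⟩
    have hexp1 : 1 ≤ Real.exp (L1 * (k * h)) := Real.one_le_exp (by positivity)
    have hd' : 0 ≤ (d + b) * Real.exp (L1 * (k * h)) - b := by nlinarith
    rw [e]
    refine (husol.nonnegNearBall_add huc hL1 hH1 hH2 hkh hhpos hkT hρ hd' hr ?_ hhr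
      (ih (Nat.le_of_succ_le hk))).mono ?_
    · intro x hx t' ht'
      have hxR := hR _ hkT' hx
      have h1 := hcδ (x, t') ⟨hxR, hkh.trans ht'.1, ht'.2.trans hkT⟩ (x, k * h)
        ⟨hxR, hkh, by linarith⟩ (by
          rw [Prod.dist_eq, dist_self, max_eq_right dist_nonneg, Real.dist_eq,
            abs_of_nonneg (sub_nonneg.2 ht'.1)]
          linarith [ht'.2])
      exact h1.le
    · have h1 : L1 * h + 1 ≤ Real.exp (L1 * h) := Real.add_one_le_exp _
      have h2 : Real.exp (L1 * (k * h + h)) = Real.exp (L1 * (k * h)) * Real.exp (L1 * h) := by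
        rw [mul_add, Real.exp_add]
      set F := (d + b) * Real.exp (L1 * (k * h)) with hF
      have hF0 : 0 ≤ F := by positivity
      have h3 : F * (L1 * h + 1) ≤ F * Real.exp (L1 * h) := by gcongr
      rw [h2, ← mul_assoc, ← hF]
      have h4 : h * (4 * r + L1 * (ρ + (F - b))) = h * (L1 * F) := by
        have : 4 * r + L1 * (ρ + (F - b)) = L1 * F + (L1 * ρ + 4 * r - L1 * b) := by ring
        rw [this, hLb]
        ring
      rw [h4]
      linarith

/-- A porous set is Lebesgue negligible. -/
theorem volume_eq_zero_of_porous {N : ℕ} {S : Set (Euc N)} (hS : MeasurableSet S) {a D : ℝ}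
    (ha : 0 < a) (h : ∀ x ∈ S, ∀ r ∈ Ioc (0 : ℝ) 1, ∃ y ∈ closedBall x (D * r),
      Disjoint S (closedBall y (a * r))) : volume S = 0 := by
  have hae := IsUnifLocDoublingMeasure.ae_tendsto_measure_inter_div
    (volume : Measure (Euc N)) S (D / a)
  have hfalse : ∀ᵐ x ∂(volume : Measure (Euc N)).restrict S, False := by
    filter_upwards [hae, ae_restrict_mem hS] with x hx hxS
    have hr : ∀ j : ℕ, (1 : ℝ) / (j + 1) ∈ Ioc (0 : ℝ) 1 := fun j =>
      ⟨by positivity, by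
        rw [div_le_one (by positivity)]
        linarith [(Nat.cast_nonneg j : (0 : ℝ) ≤ j)]⟩
    choose y hy hdisj using fun j : ℕ => h x hxS _ (hr j)
    have hδ : Tendsto (fun j : ℕ => a * (1 / ((j : ℝ) + 1))) atTop (𝓝[>] 0) := by
      refine tendsto_nhdsWithin_iff.2 ⟨?_, Eventually.of_forall fun j => mul_pos ha (hr j).1⟩
      simpa using tendsto_one_div_add_atTop_nhds_zero_nat.const_mul a
    have hlim := hx y _ hδ (Eventually.of_forall fun j => by
      have := hy j
      rw [mem_closedBall_comm] at this
      convert this using 1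
      field_simp)
    have hz : ∀ j : ℕ, volume (S ∩ closedBall (y j) (a * (1 / ((j : ℝ) + 1)))) /
        volume (closedBall (y j) (a * (1 / ((j : ℝ) + 1)))) = 0 := fun j => by
      rw [(hdisj j).inter_eq, measure_empty, ENNReal.zero_div]
    simp only [hz] at hlim
    exact zero_ne_one (tendsto_nhds_unique tendsto_const_nhds hlim)
  rwa [eventually_false_iff_eq_bot, ae_eq_bot, Measure.restrict_eq_zero] at hfalse

/-- If the zero set of `u · t` is negligible, the nonnegativity sets vary continuously in measure
at `t`. -/
theorem tendsto_volume_symmDiff_nonneg {N : ℕ} {T : ℝ} {u : Euc N → ℝ → ℝ}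
    (huc : ContinuousOn (fun p : Euc N × ℝ => u p.1 p.2)
      ((Set.univ : Set (Euc N)) ×ˢ Set.Icc (0 : ℝ) T))
    {R : ℝ} (hR : ∀ t ∈ Icc 0 T, {x | 0 ≤ u x t} ⊆ closedBall 0 R) {t : ℝ} (ht : t ∈ Icc 0 T)
    (hzero : volume {x : Euc N | u x t = 0} = 0) :
    Tendsto (fun s => volume ({x : Euc N | 0 ≤ u x s} ∆ {x : Euc N | 0 ≤ u x t}))
      (𝓝[Set.Icc (0 : ℝ) T] t) (𝓝 0) := by
  classical
  have hmeas : ∀ s ∈ Icc 0 T, MeasurableSet {x : Euc N | 0 ≤ u x s} := fun s hs =>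
    (isClosed_le continuous_const (continuous_slice huc hs)).measurableSet
  set A : ℝ → Set (Euc N) := fun s =>
    if s ∈ Icc 0 T then {x : Euc N | 0 ≤ u x s} ∆ {x : Euc N | 0 ≤ u x t} else ∅ with hA
  have hAs : ∀ s ∈ Icc 0 T, A s = {x : Euc N | 0 ≤ u x s} ∆ {x : Euc N | 0 ≤ u x t} :=
    fun s hs => if_pos hs
  have hmem : ∀ᶠ s in 𝓝[Icc (0 : ℝ) T] t, s ∈ Icc 0 T := self_mem_nhdsWithin
  have hlim := tendsto_measure_of_ae_tendsto_indicator (μ := (volume : Measure (Euc N)))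
    (𝓝[Icc (0 : ℝ) T] t) (A := ∅) (As := A) (B := closedBall 0 R) MeasurableSet.empty
    (fun s => by
      by_cases hs : s ∈ Icc 0 T
      · rw [hAs s hs]
        exact (hmeas s hs).symmDiff (hmeas t ht)
      · simp only [hA, if_neg hs, MeasurableSet.empty])
    measurableSet_closedBall measure_closedBall_lt_top.ne
    (by
      filter_upwards [hmem] with s hs
      rw [hAs s hs]
      exact symmDiff_le_sup.trans (sup_le (hR s hs) (hR t ht)))
    (by
      have hne : ∀ᵐ x : Euc N, u x t ≠ 0 := by
        rw [ae_iff]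
        simpa using hzero
      filter_upwards [hne] with x hx
      have hcx : Tendsto (u x) (𝓝[Icc (0 : ℝ) T] t) (𝓝 (u x t)) := continuousOn_slice huc x t ht
      rcases hx.lt_or_gt with hx | hx
      · filter_upwards [hmem, hcx.eventually_lt_const hx] with s hs hsx
        simp [hAs s hs, mem_symmDiff, hx, hsx]
      · filter_upwards [hmem, hcx.eventually_const_lt hx] with s hs hsx
        simp [hAs s hs, mem_symmDiff, hx.le, hsx.le])
  rw [measure_empty] at hlim
  refine hlim.congr' ?_
  filter_upwards [hmem] with s hs
  rw [hAs s hs]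

/-- the front has zero Lebesgue measure and the indicator function of the
positivity set is continuous in time for the L¹-norm. -/
theorem stmt6 (N : ℕ) (hN : 1 ≤ N) (T : ℝ) (hT : 0 < T)
    (c : Euc N → ℝ → ℝ)
    (hc : ContinuousOn (fun p : Euc N × ℝ => c p.1 p.2)
      ((Set.univ : Set (Euc N)) ×ˢ Set.Icc (0 : ℝ) T))
    (L1 L1' : ℝ) (hL1 : 0 < L1) (hL1' : 0 < L1')
    (hH1 : ∀ x y : Euc N, ∀ t ∈ Set.Icc (0 : ℝ) T,
      |c x t - c y t| ≤ L1 * ‖x - y‖ ∧ |c x t| ≤ L1')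
    (hH2 : ∀ x : Euc N, ∀ t ∈ Set.Icc (0 : ℝ) T, 0 ≤ c x t)
    (u0 : Euc N → ℝ) (K : ℝ≥0) (hu0 : LipschitzWith K u0)
    (η0 : ℝ) (hη0 : 0 < η0)
    (hH3 : ∀ x : Euc N, ∀ p ∈ SuperDiff u0 x, η0 ≤ |u0 x| + ‖p‖)
    (hcpt : IsCompact {x : Euc N | 0 ≤ u0 x})
    (u : Euc N → ℝ → ℝ)
    (huc : ContinuousOn (fun p : Euc N × ℝ => u p.1 p.2)
      ((Set.univ : Set (Euc N)) ×ˢ Set.Icc (0 : ℝ) T))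
    (husol : IsViscositySolution N T c u u0) :
    (∀ t ∈ Set.Icc (0 : ℝ) T, volume {x : Euc N | u x t = 0} = 0) ∧
    (∀ t ∈ Set.Icc (0 : ℝ) T,
      Tendsto (fun s => volume ({x : Euc N | 0 ≤ u x s} ∆ {x : Euc N | 0 ≤ u x t}))
        (𝓝[Set.Icc (0 : ℝ) T] t) (𝓝 0)) := by
  have hcC : ∀ x, ∀ t ∈ Icc 0 T, c x t ≤ L1' := fun x t ht =>
    (le_abs_self _).trans (hH1 x x t ht).2
  obtain ⟨R, hR⟩ := husol.exists_nonneg_subset_closedBall huc hL1'.le hcC hcpt.isBounded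
  have hzero : ∀ t ∈ Set.Icc (0 : ℝ) T, volume {x : Euc N | u x t = 0} = 0 := by
    intro t ht
    have hK : (0 : ℝ) ≤ K := K.2
    set a := η0 / (8 * (K + 1)) with ha
    have ha0 : 0 < a := by positivity
    refine volume_eq_zero_of_porous (a := a) (D := (1 + a + 4 / L1) * Real.exp (L1 * t))
      (isClosed_eq (continuous_slice huc ht) continuous_const).measurableSet ha0 ?_
    intro x hx r hr
    have hr0 := hr.1
    obtain ⟨y, hy, hyw⟩ := husol.nonnegNearBall hc huc hL1 hL1' hH1 hH2 hR
      (by positivity : 0 ≤ a * r) hr0.le hr0 (hu0.nonnegNearBall hη0 hH3 hr0 hr.2) ht x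
      (le_of_eq (Eq.symm hx))
    refine ⟨y, ?_, Set.disjoint_left.2 fun w hw hwy => ?_⟩
    · have e : (1 + a + 4 / L1) * Real.exp (L1 * t) * r =
          (r + a * r + 4 * r / L1) * Real.exp (L1 * t) := by ring
      rwa [e]
    · have h1 : η0 / 8 * r ≤ u w t := hyw w hwy
      have h2 : u w t = 0 := hw
      have h3 : 0 < η0 / 8 * r := by positivity
      linarith
  exact ⟨hzero, fun t ht => tendsto_volume_symmDiff_nonneg huc hR ht (hzero t ht)⟩
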